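/- arXiv:0711.1662 — 3 statements merged into one kernel-verified Lean document; each statement's English description precedes it below -/
import Mathlib

section
/- Let δ > 0 and let f, g : ℝ → ℝ be functions with f(t) > 0 and g(t) > 0 for all t > 0, and suppose there are constants 0 < c ≤ C such that c · f(t) ≤ g(t) ≤ C · f(t) for all t > 0. Then there exist real numbers α, β and constants C₁, C₂ > 0 such that for all t ≥ δ one has F_δ(g)(t) ≤ C₁ · t^{α} · F_δ(f)(t) and F_δ(f)(t) ≤ C₂ · t^{β} · F_δ(g)(t). -/
open Real Filter Finset
open scoped ENNReal

/-- `kappa δ t` is the least natural number `k` such that `t / 2^k < δ`. -/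
noncomputable def kappa (δ t : ℝ) : ℕ := sInf {k : ℕ | t / 2 ^ k < δ}

/-- `Fdel δ f t = ∏_{k=0}^{kappa δ t - 1} f (t / 2^k)` (empty product is `1`). -/
noncomputable def Fdel (δ : ℝ) (f : ℝ → ℝ) (t : ℝ) : ℝ :=
  ∏ k ∈ Finset.range (kappa δ t), f (t / 2 ^ k)

/-- The number of halvings needed to bring `t ≥ δ` below `δ` is logarithmic in `t / δ`. -/
theorem two_pow_kappa_le {δ t : ℝ} (hδ : 0 < δ) (ht : δ ≤ t) :
    (2 : ℝ) ^ kappa δ t ≤ 2 / δ * t := by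
  have h1 : 1 ≤ t / δ := (one_le_div hδ).2 ht
  have h2 : 2 / δ * t = 2 * (t / δ) := by ring
  rw [h2]
  rcases hk : kappa δ t with _ | n
  · rw [pow_zero]; linarith
  · have hn : n ∉ {k : ℕ | t / 2 ^ k < δ} :=
      Nat.notMem_of_lt_sInf (by change n < kappa δ t; omega)
    have hn' : δ ≤ t / 2 ^ n := not_lt.1 hn
    rw [le_div_iff₀ (by positivity)] at hn'
    have : (2 : ℝ) ^ n ≤ t / δ := by
      rw [le_div_iff₀ hδ]; linarith
    rw [pow_succ]; linarith

/-- A one-sided comparison `u ≤ A * v` passes to `Fdel` up to a power of `t`. -/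
theorem exists_Fdel_le {δ : ℝ} (hδ : 0 < δ) {u v : ℝ → ℝ} {A : ℝ} (hA : 1 ≤ A)
    (hu : ∀ t > 0, 0 < u t) (hv : ∀ t > 0, 0 < v t) (h : ∀ t > 0, u t ≤ A * v t) :
    ∃ a : ℝ, ∃ K > (0 : ℝ), ∀ t ≥ δ, Fdel δ u t ≤ K * t ^ a * Fdel δ v t := by
  refine ⟨Real.logb 2 A, (2 / δ) ^ Real.logb 2 A, by positivity, fun t ht => ?_⟩
  have ht0 : 0 < t := hδ.trans_le ht
  have hpos : ∀ k : ℕ, 0 < t / 2 ^ k := fun k => by positivity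
  have hprod : Fdel δ u t ≤ A ^ kappa δ t * Fdel δ v t := by
    calc Fdel δ u t ≤ ∏ k ∈ Finset.range (kappa δ t), A * v (t / 2 ^ k) :=
          Finset.prod_le_prod (fun k _ => (hu _ (hpos k)).le) (fun k _ => h _ (hpos k))
      _ = A ^ kappa δ t * Fdel δ v t := by
          rw [Finset.prod_mul_distrib, Finset.prod_const, Finset.card_range, Fdel]
  have hpow : A ^ kappa δ t ≤ (2 / δ) ^ Real.logb 2 A * t ^ Real.logb 2 A := by
    calc A ^ kappa δ t = ((2 : ℝ) ^ Real.logb 2 A) ^ kappa δ t := by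
          rw [Real.rpow_logb two_pos (by norm_num) (by linarith)]
      _ = ((2 : ℝ) ^ kappa δ t) ^ Real.logb 2 A :=
          (Real.rpow_pow_comm two_pos.le _ _)
      _ ≤ (2 / δ * t) ^ Real.logb 2 A :=
          Real.rpow_le_rpow (by positivity) (two_pow_kappa_le hδ ht)
            (Real.logb_nonneg one_lt_two hA)
      _ = (2 / δ) ^ Real.logb 2 A * t ^ Real.logb 2 A :=
          Real.mul_rpow (by positivity) ht0.le
  exact hprod.trans (mul_le_mul_of_nonneg_right hpow
    (Finset.prod_nonneg fun k _ => (hv _ (hpos k)).le))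

/-- If `f, g > 0` on the positive reals and `c * f ≤ g ≤ C * f` there, with
`0 < c ≤ C`, then `F_δ(g) ≤ C₁ * t ^ α * F_δ(f)` and `F_δ(f) ≤ C₂ * t ^ β * F_δ(g)`
for suitable constants. -/
theorem Fdel_sim (δ : ℝ) (hδ : 0 < δ) (f g : ℝ → ℝ) (c C : ℝ)
    (hc : 0 < c) (hcC : c ≤ C)
    (hf : ∀ t > 0, 0 < f t) (hg : ∀ t > 0, 0 < g t)
    (h : ∀ t > 0, c * f t ≤ g t ∧ g t ≤ C * f t) :
    ∃ α β : ℝ, ∃ C₁ > (0 : ℝ), ∃ C₂ > (0 : ℝ), ∀ t ≥ δ,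
      Fdel δ g t ≤ C₁ * t ^ α * Fdel δ f t ∧
      Fdel δ f t ≤ C₂ * t ^ β * Fdel δ g t := by
  obtain ⟨α, C₁, hC₁, h₁⟩ := exists_Fdel_le hδ (le_max_right C 1) hg hf fun t ht =>
    (h t ht).2.trans (mul_le_mul_of_nonneg_right (le_max_left C 1) (hf t ht).le)
  obtain ⟨β, C₂, hC₂, h₂⟩ := exists_Fdel_le hδ (le_max_right c⁻¹ 1) hf hg fun t ht =>
    ((le_inv_mul_iff₀ hc).2 (h t ht).1).trans
      (mul_le_mul_of_nonneg_right (le_max_left c⁻¹ 1) (hg t ht).le)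
  exact ⟨α, β, C₁, hC₁, C₂, hC₂, fun t ht => ⟨h₁ t ht, h₂ t ht⟩⟩
end

section
/- Let δ > 0, let a ≥ 0, let c ≥ 1, and let f : ℝ → ℝ be a function with 0 ≤ f(t) ≤ c · e^{at} for all t > 0. Then F_δ(f)(t) ≤ c · (t/δ)^{log₂ c} · e^{2at} for all t ≥ δ; consequently, for every ε > 0 there exists C > 0 such that F_δ(f)(t) ≤ C · e^{(2a+ε)t} for all t > 0. -/
open Real Filter Finset
open scoped ENNReal

theorem kappa_eq_zero {δ t : ℝ} (h : t < δ) : kappa δ t = 0 :=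
  Nat.sInf_eq_zero.2 (Or.inl (by simpa using h))

theorem le_div_two_pow_of_lt_kappa {δ t : ℝ} {k : ℕ} (h : k < kappa δ t) : δ ≤ t / 2 ^ k :=
  not_lt.1 (Nat.notMem_of_lt_sInf h)

theorem sum_div_two_pow_le {t : ℝ} (ht : 0 ≤ t) (n : ℕ) :
    ∑ k ∈ Finset.range n, t / 2 ^ k ≤ 2 * t := by
  have h : ∑ k ∈ Finset.range n, t / 2 ^ k = 2 * t - 2 * t / 2 ^ n := by
    induction n with
    | zero => simp
    | succ n ih =>
      rw [Finset.sum_range_succ, ih, pow_succ]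
      field_simp
      ring
  rw [h]
  exact sub_le_self _ (by positivity)

theorem prod_div_two_pow_le {a c t : ℝ} {f : ℝ → ℝ} (ha : 0 ≤ a) (hc : 0 ≤ c)
    (hf : ∀ t > 0, 0 ≤ f t ∧ f t ≤ c * Real.exp (a * t)) (ht : 0 < t) (n : ℕ) :
    ∏ k ∈ Finset.range n, f (t / 2 ^ k) ≤ c ^ n * Real.exp (2 * a * t) := by
  calc ∏ k ∈ Finset.range n, f (t / 2 ^ k)
      ≤ ∏ k ∈ Finset.range n, c * Real.exp (a * (t / 2 ^ k)) :=
        Finset.prod_le_prod (fun k _ => (hf _ (by positivity)).1)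
          (fun k _ => (hf _ (by positivity)).2)
    _ = c ^ n * Real.exp (a * ∑ k ∈ Finset.range n, t / 2 ^ k) := by
        rw [Finset.prod_mul_distrib, Finset.prod_const, Finset.card_range, ← Real.exp_sum,
          Finset.mul_sum]
    _ ≤ c ^ n * Real.exp (2 * a * t) := by
        rw [mul_comm 2 a, mul_assoc]
        gcongr
        exact sum_div_two_pow_le ht.le n

theorem pow_kappa_le {δ c t : ℝ} (hδ : 0 < δ) (hc : 1 ≤ c) (ht : δ ≤ t) :
    c ^ kappa δ t ≤ c * (t / δ) ^ Real.logb 2 c := by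
  have hp : 0 ≤ Real.logb 2 c := Real.logb_nonneg one_lt_two hc
  rcases hk : kappa δ t with _ | m
  · have h := Real.one_le_rpow ((one_le_div hδ).2 ht) hp
    rw [pow_zero]
    nlinarith
  · have hm : δ ≤ t / 2 ^ m := le_div_two_pow_of_lt_kappa (by omega)
    have hm' : (2 : ℝ) ^ m ≤ t / δ := by
      rw [le_div_iff₀ (by positivity)] at hm
      rw [le_div_iff₀ hδ]
      linarith
    have h : c ^ m = ((2 : ℝ) ^ m) ^ Real.logb 2 c := by
      rw [← Real.rpow_natCast 2 m, ← Real.rpow_mul zero_le_two, mul_comm,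
        Real.rpow_mul zero_le_two, Real.rpow_logb two_pos (by simp) (by linarith),
        Real.rpow_natCast]
    rw [pow_succ', h]
    gcongr

theorem rpow_div_le_mul_exp {δ ε p t : ℝ} (hδ : 0 < δ) (hε : 0 < ε) (hp : 0 ≤ p) (ht : δ ≤ t) :
    (t / δ) ^ p ≤ ((p + 1) / (ε * δ)) ^ (p + 1) * Real.exp (ε * t) := by
  have hp1 : 0 < p + 1 := by linarith
  have ht0 : 0 < t := hδ.trans_le ht
  have h : t / δ ≤ (p + 1) / (ε * δ) * Real.exp (ε * t / (p + 1)) := by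
    calc t / δ = (p + 1) / (ε * δ) * (ε * t / (p + 1)) := by field_simp
      _ ≤ _ := by
        gcongr
        linarith [Real.add_one_le_exp (ε * t / (p + 1))]
  calc (t / δ) ^ p ≤ (t / δ) ^ (p + 1) :=
        Real.rpow_le_rpow_of_exponent_le ((one_le_div hδ).2 ht) (by linarith)
    _ ≤ ((p + 1) / (ε * δ) * Real.exp (ε * t / (p + 1))) ^ (p + 1) := by gcongr
    _ = _ := by
        rw [Real.mul_rpow (by positivity) (by positivity), ← Real.exp_mul,
          div_mul_cancel₀ _ hp1.ne']

/-- If `0 ≤ f t ≤ c * exp (a * t)` on the positive reals with `a ≥ 0`, `c ≥ 1`, then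
`F_δ(f)(t) ≤ c * (t/δ) ^ (log₂ c) * exp (2 * a * t)` for `t ≥ δ`; consequently, for
every `ε > 0` there is `C > 0` with `F_δ(f)(t) ≤ C * exp ((2*a + ε) * t)` for `t > 0`. -/
theorem Fdel_exp_bound (δ a c : ℝ) (hδ : 0 < δ) (ha : 0 ≤ a) (hc : 1 ≤ c)
    (f : ℝ → ℝ) (hf : ∀ t > 0, 0 ≤ f t ∧ f t ≤ c * Real.exp (a * t)) :
    (∀ t ≥ δ,
      Fdel δ f t ≤ c * (t / δ) ^ (Real.logb 2 c) * Real.exp (2 * a * t)) ∧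
    ∀ ε > (0 : ℝ), ∃ C > (0 : ℝ), ∀ t > 0,
      Fdel δ f t ≤ C * Real.exp ((2 * a + ε) * t) := by
  have hc0 : 0 < c := by linarith
  have hmain : ∀ t ≥ δ,
      Fdel δ f t ≤ c * (t / δ) ^ (Real.logb 2 c) * Real.exp (2 * a * t) := fun t ht =>
    (prod_div_two_pow_le ha hc0.le hf (hδ.trans_le ht) _).trans
      (mul_le_mul_of_nonneg_right (pow_kappa_le hδ hc ht) (Real.exp_pos _).le)
  refine ⟨hmain, fun ε hε => ?_⟩
  have hp : 0 ≤ Real.logb 2 c := Real.logb_nonneg one_lt_two hc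
  set K := ((Real.logb 2 c + 1) / (ε * δ)) ^ (Real.logb 2 c + 1) with hK
  have hK0 : 0 ≤ K := by positivity
  refine ⟨c * K + 1, by positivity, fun t ht => ?_⟩
  rcases lt_or_ge t δ with h | h
  · have h1 : 1 ≤ Real.exp ((2 * a + ε) * t) := Real.one_le_exp (by positivity)
    have h2 : 0 ≤ c * K := by positivity
    rw [Fdel, kappa_eq_zero h, Finset.prod_range_zero]
    nlinarith
  · calc Fdel δ f t ≤ c * (t / δ) ^ (Real.logb 2 c) * Real.exp (2 * a * t) := hmain t h
      _ ≤ c * (K * Real.exp (ε * t)) * Real.exp (2 * a * t) := by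
          gcongr
          exact rpow_div_le_mul_exp hδ hε hp h
      _ = c * K * Real.exp ((2 * a + ε) * t) := by
          rw [add_mul, Real.exp_add]
          ring
      _ ≤ (c * K + 1) * Real.exp ((2 * a + ε) * t) := by
          gcongr
          linarith
end

section
/- Let δ > 0, let n be a natural number, let c ≥ 1, and let f : ℝ → ℝ be a function with 0 ≤ f(t) ≤ c · (max(1, t))^{n} for all t > 0. Then there exist a real number α > 0, a constant C > 0, and T > 0 such that F_δ(f)(t) ≤ C · t^{α · log₂ t} for all t ≥ T. -/
open Real Filter Finset
open scoped ENNReal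

theorem kappa_le_of_div_lt {δ t : ℝ} {k : ℕ} (h : t / 2 ^ k < δ) : kappa δ t ≤ k :=
  Nat.sInf_le h

theorem kappa_le_three_mul_logb {δ t : ℝ} (hδ : 0 < δ) (ht : 2 ≤ t) (htδ : 1 / δ ≤ t) :
    (kappa δ t : ℝ) ≤ 3 * Real.logb 2 t := by
  have ht0 : 0 < t := by linarith
  have hL : 1 ≤ Real.logb 2 t := by
    rwa [Real.le_logb_iff_rpow_le one_lt_two ht0, Real.rpow_one]
  have hpow : t ^ 2 < 2 ^ (⌊2 * Real.logb 2 t⌋₊ + 1) := by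
    calc t ^ 2 = (2 : ℝ) ^ (2 * Real.logb 2 t) := by
          rw [mul_comm, Real.rpow_mul zero_le_two,
            Real.rpow_logb two_pos (by norm_num) ht0, Real.rpow_two]
      _ < (2 : ℝ) ^ ((⌊2 * Real.logb 2 t⌋₊ + 1 : ℕ) : ℝ) := by
          apply Real.rpow_lt_rpow_of_exponent_lt one_lt_two
          push_cast
          exact Nat.lt_floor_add_one _
      _ = 2 ^ (⌊2 * Real.logb 2 t⌋₊ + 1) := Real.rpow_natCast _ _
  have hκ : kappa δ t ≤ ⌊2 * Real.logb 2 t⌋₊ + 1 := by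
    apply kappa_le_of_div_lt
    rw [div_lt_iff₀ (by positivity)]
    rw [div_le_iff₀ hδ] at htδ
    calc t ≤ δ * t ^ 2 := by nlinarith
      _ < _ := by gcongr
  have hκ' : (kappa δ t : ℝ) ≤ ⌊2 * Real.logb 2 t⌋₊ + 1 := mod_cast hκ
  have hfloor := Nat.floor_le (show 0 ≤ 2 * Real.logb 2 t by linarith)
  linarith

/-- If `0 ≤ f t ≤ c * (max 1 t) ^ n` on the positive reals with `c ≥ 1`, then
`F_δ(f)(t) ≤ C * t ^ (α * log₂ t)` for suitable `α, C > 0` and all large `t`. -/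
theorem Fdel_poly_bound (δ : ℝ) (hδ : 0 < δ) (n : ℕ) (c : ℝ) (hc : 1 ≤ c)
    (f : ℝ → ℝ) (hf : ∀ t > 0, 0 ≤ f t ∧ f t ≤ c * (max 1 t) ^ n) :
    ∃ α > (0 : ℝ), ∃ C > (0 : ℝ), ∃ T > (0 : ℝ), ∀ t ≥ T,
      Fdel δ f t ≤ C * t ^ (α * Real.logb 2 t) := by
  refine ⟨3 * (n + 1), by positivity, 1, one_pos, max (max 2 (1 / δ)) c, by positivity, ?_⟩
  intro t ht
  simp only [ge_iff_le, max_le_iff] at ht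
  obtain ⟨⟨ht2, htδ⟩, htc⟩ := ht
  have ht1 : 1 ≤ t := by linarith
  have ht0 : 0 < t := by linarith
  have hfactor (k : ℕ) : 0 ≤ f (t / 2 ^ k) ∧ f (t / 2 ^ k) ≤ t ^ (n + 1) := by
    obtain ⟨h0, h1⟩ := hf (t / 2 ^ k) (by positivity)
    refine ⟨h0, h1.trans ?_⟩
    have hmax : max 1 (t / 2 ^ k) ≤ t :=
      max_le ht1 (div_le_self ht0.le (one_le_pow₀ one_le_two))
    rw [pow_succ']
    gcongr
  calc Fdel δ f t ≤ ∏ _k ∈ Finset.range (kappa δ t), t ^ (n + 1) :=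
        Finset.prod_le_prod (fun k _ => (hfactor k).1) fun k _ => (hfactor k).2
    _ = t ^ (((n + 1) * kappa δ t : ℕ) : ℝ) := by
        rw [Finset.prod_const, Finset.card_range, ← pow_mul, Real.rpow_natCast]
    _ ≤ t ^ (3 * (n + 1) * Real.logb 2 t) := by
        apply Real.rpow_le_rpow_of_exponent_le ht1
        push_cast
        rw [mul_comm 3, mul_assoc]
        gcongr
        exact kappa_le_three_mul_logb hδ ht2 htδ
    _ = 1 * t ^ (3 * (n + 1) * Real.logb 2 t) := (one_mul _).symm
end
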